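/- If a_1, ..., a_n are even positive integers, then Z(z_{a_1} ш ··· ш z_{a_n}) is a rational multiple of π^{a_1 + ··· + a_n}, where Z is the multiple zeta value evaluation map Z(z_{k_1}···z_{k_m}) = ζ(k_1,...,k_m). -/

import Mathlib

noncomputable section

/-- `H = ℚ⟨x,y⟩`, the free noncommutative polynomial algebra on two generators. -/
abbrev H : Type := FreeAlgebra ℚ (Fin 2)

/-- The generator `x`. -/
def Hx : H := FreeAlgebra.ι ℚ 0

/-- The generator `y`. -/
def Hy : H := FreeAlgebra.ι ℚ 1

/-- `z_a = x^{a-1} y`. -/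
def z (a : ℕ) : H := Hx ^ (a - 1) * Hy

/-- Membership in `H¹ = ℚ + H·y`. -/
def H1mem (w : H) : Prop := ∃ (q : ℚ) (v : H), w = algebraMap ℚ H q + v * Hy

/-- The multiple zeta value `ζ(k_1,…,k_n) = ∑_{m_1 > ⋯ > m_n > 0} 1/(m_1^{k_1} ⋯ m_n^{k_n})`. -/
def mz {n : ℕ} (k : Fin n → ℕ) : ℝ :=
  ∑' f : {f : Fin n → ℕ // (∀ i, 0 < f i) ∧ ∀ i j : Fin n, i < j → f j < f i},
    ∏ i, ((f.1 i : ℝ) ^ (k i))⁻¹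

open scoped ENNReal

section Shuffle

lemma H1mem_prod_map_z (l : List ℕ) : H1mem (l.map z).prod := by
  induction l with
  | nil => exact ⟨1, 0, by simp⟩
  | cons b l ih =>
    obtain ⟨q, v, h⟩ := ih
    refine ⟨0, q • Hx ^ (b - 1) + z b * v, ?_⟩
    rw [List.map_cons, List.prod_cons, h, mul_add, add_mul, ← mul_assoc, map_zero, zero_add,
      ← Algebra.commutes, ← Algebra.smul_def, smul_mul_assoc]
    rfl

lemma sh_z_prod_map_z (sh : H →ₗ[ℚ] H →ₗ[ℚ] H)
    (hshL : ∀ w : H, H1mem w → sh 1 w = w)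
    (hshR : ∀ w : H, H1mem w → sh w 1 = w)
    (hshrec : ∀ (a b : ℕ), 1 ≤ a → 1 ≤ b → ∀ w w' : H, H1mem w → H1mem w' →
      sh (z a * w) (z b * w') = z a * sh w (z b * w') + z b * sh (z a * w) w')
    {b : ℕ} (hb : 1 ≤ b) (l : List ℕ) (hl : ∀ c ∈ l, 1 ≤ c) :
    sh (z b) (l.map z).prod =
      ((l.permutations'Aux b).map fun t => (t.map z).prod).sum := by
  have hzb : H1mem (z b) := by simpa using H1mem_prod_map_z [b]
  induction l with
  | nil => simpa using hshR _ hzb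
  | cons c l ih =>
    have h1 : H1mem 1 := by simpa using H1mem_prod_map_z []
    have h := hshrec b c hb (hl c (by simp)) 1 (l.map z).prod h1 (H1mem_prod_map_z l)
    rw [mul_one, ih fun d hd => hl d (by simp [hd]), ← List.prod_cons, ← List.map_cons,
      hshL _ (H1mem_prod_map_z _)] at h
    rw [h]
    simp [List.permutations'Aux, List.sum_map_mul_left, Function.comp_def]

lemma foldr_sh_eq_sum_permutations' (sh : H →ₗ[ℚ] H →ₗ[ℚ] H)
    (hshL : ∀ w : H, H1mem w → sh 1 w = w)
    (hshR : ∀ w : H, H1mem w → sh w 1 = w)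
    (hshrec : ∀ (a b : ℕ), 1 ≤ a → 1 ≤ b → ∀ w w' : H, H1mem w → H1mem w' →
      sh (z a * w) (z b * w') = z a * sh w (z b * w') + z b * sh (z a * w) w')
    (l : List ℕ) (hl : ∀ c ∈ l, 1 ≤ c) :
    (l.map z).foldr (fun u v => sh u v) 1 =
      (l.permutations'.map fun t => (t.map z).prod).sum := by
  induction l with
  | nil => simp
  | cons b l ih =>
    rw [List.map_cons, List.foldr_cons, ih fun d hd => hl d (by simp [hd]), map_list_sum,
      List.permutations', List.map_flatMap, List.flatMap_def, List.sum_flatten, List.map_map,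
      List.map_map]
    congr 1
    refine List.map_congr_left fun t ht => ?_
    refine sh_z_prod_map_z sh hshL hshR hshrec (hl b (by simp)) t fun c hc => hl c ?_
    exact List.mem_cons_of_mem _ ((List.mem_permutations'.1 ht).subset hc)

end Shuffle

lemma sum_permutations'_ofFn {α M : Type*} [AddCommMonoid M] {n : ℕ} (a : Fin n → α)
    (F : List α → M) :
    ((List.ofFn a).permutations'.map F).sum =
      ∑ σ : Equiv.Perm (Fin n), F (List.ofFn (a ∘ σ)) := by
  have hnd : (List.finRange n).permutations'.Nodup :=
    (List.permutations_perm_permutations' _).nodup_iff.1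
      (List.nodup_permutations _ (List.nodup_finRange n))
  rw [List.ofFn_eq_map, ← List.map_permutations', List.map_map, ← List.sum_toFinset _ hnd]
  symm
  refine Finset.sum_bij (fun σ _ => List.ofFn σ) ?_ ?_ ?_ ?_
  · intro σ _
    simpa [List.ofFn_eq_map] using σ.map_finRange_perm
  · intro σ _ τ _ h
    exact Equiv.coe_fn_injective (List.ofFn_injective h)
  · intro l hl
    have hp : l.Perm (List.finRange n) := by simpa using hl
    have hlen : l.length = n := by simpa using hp.length_eq
    obtain ⟨g, rfl⟩ : ∃ g : Fin n → Fin n, List.ofFn g = l :=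
      ⟨fun i => l.get (i.cast hlen.symm), List.ext_getElem (by simp [hlen]) (by simp)⟩
    have hinj : Function.Injective g := List.nodup_ofFn.1
      (hp.nodup_iff.2 (List.nodup_finRange _))
    exact ⟨Equiv.ofBijective _ (Finite.injective_iff_bijective.1 hinj), Finset.mem_univ _, rfl⟩
  · intro σ _
    simp [List.map_ofFn]

section Series

/-- The value `m ^ (-k)`, as an extended nonnegative real. -/
def invPow (m : ℕ+) (k : ℕ) : ℝ≥0∞ := ENNReal.ofReal (((m : ℝ) ^ k)⁻¹)

lemma invPow_zero (m : ℕ+) : invPow m 0 = 1 := by simp [invPow]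

lemma invPow_add (m : ℕ+) (k l : ℕ) : invPow m (k + l) = invPow m k * invPow m l := by
  rw [invPow, invPow, invPow, ← ENNReal.ofReal_mul (by positivity), pow_add, mul_inv]

/-- The sum of `∏ i, f i ^ (-a i)` over all tuples `f` of distinct positive integers. -/
def injSum {n : ℕ} (a : Fin n → ℕ) : ℝ≥0∞ := ∑' f : Fin n ↪ ℕ+, ∏ i, invPow (f i) (a i)

lemma tsum_invPow_mul_injSum {n : ℕ} (b : ℕ) (a : Fin n → ℕ) :
    (∑' m, invPow m b) * injSum a =
      injSum (Fin.cons b a : Fin (n + 1) → ℕ) + ∑ j, injSum (a + Pi.single j b) := by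
  let F : (Fin (n + 1) ↪ ℕ+) ⊕ (Fin n × (Fin n ↪ ℕ+)) → ℕ+ × (Fin n ↪ ℕ+) :=
    Sum.elim (fun g => (g 0, (Fin.succEmb n).trans g)) fun p => (p.2 p.1, p.2)
  have hF : Function.Bijective F := by
    constructor
    · rintro (g | ⟨j, f⟩) (g' | ⟨j', f'⟩) h
      · simp only [F, Sum.elim_inl, Prod.mk.injEq] at h
        congr 1
        ext i
        refine Fin.cases ?_ (fun i => ?_) i
        · rw [h.1]
        · exact DFunLike.congr_fun h.2 i
      · simp only [F, Sum.elim_inl, Sum.elim_inr, Prod.mk.injEq] at h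
        have h2 := DFunLike.congr_fun h.2 j'
        rw [← h.1] at h2
        exact absurd (g.injective h2) (Fin.succ_ne_zero j')
      · simp only [F, Sum.elim_inl, Sum.elim_inr, Prod.mk.injEq] at h
        have h2 := DFunLike.congr_fun h.2 j
        rw [h.1] at h2
        exact absurd (g'.injective h2).symm (Fin.succ_ne_zero j)
      · simp only [F, Sum.elim_inr, Prod.mk.injEq] at h
        obtain ⟨h1, rfl⟩ := h
        rw [f.injective h1]
    · rintro ⟨m, f⟩
      by_cases hm : m ∈ Set.range f
      · obtain ⟨j, rfl⟩ := hm
        exact ⟨Sum.inr (j, f), rfl⟩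
      · exact ⟨Sum.inl ⟨Fin.cons m f, Fin.cons_injective_iff.2 ⟨hm, f.injective⟩⟩, rfl⟩
  rw [injSum, ← ENNReal.tsum_mul_right]
  simp_rw [← ENNReal.tsum_mul_left]
  rw [← ENNReal.tsum_prod (f := fun m (f : Fin n ↪ ℕ+) => invPow m b * ∏ i, invPow (f i) (a i)),
    ← (Equiv.ofBijective F hF).tsum_eq, Summable.tsum_sum ENNReal.summable ENNReal.summable]
  congr 1
  · refine tsum_congr fun g => ?_
    rw [Fin.prod_univ_succ]
    rfl
  · rw [ENNReal.tsum_prod', tsum_fintype]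
    refine Finset.sum_congr rfl fun j _ => tsum_congr fun f => ?_
    simp only [Pi.add_apply, invPow_add, Finset.prod_mul_distrib]
    rw [mul_comm]
    congr 1
    rw [Finset.prod_eq_single j]
    · simp [F]
    · intro i _ hi
      simp [hi, invPow_zero]
    · simp

lemma tsum_invPow_even {b : ℕ} (hb : 0 < b) (he : Even b) :
    ∃ q : ℚ, 0 ≤ q * Real.pi ^ b ∧ ∑' m, invPow m b = ENNReal.ofReal (q * Real.pi ^ b) := by
  obtain ⟨k, rfl⟩ := even_iff_two_dvd.1 he
  have hs := hasSum_zeta_nat (k := k) (by omega)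
  refine ⟨(-1) ^ (k + 1) * 2 ^ (2 * k - 1) * bernoulli (2 * k) / (2 * k).factorial, ?_⟩
  have hq : (((-1) ^ (k + 1) * 2 ^ (2 * k - 1) * bernoulli (2 * k) / (2 * k).factorial : ℚ) : ℝ)
      * Real.pi ^ (2 * k) = ∑' m : ℕ, 1 / (m : ℝ) ^ (2 * k) := by
    rw [hs.tsum_eq]
    push_cast
    ring
  rw [hq]
  refine ⟨tsum_nonneg fun m => by positivity, ?_⟩
  rw [ENNReal.ofReal_tsum_of_nonneg (fun m => by positivity) hs.summable,
    tsum_eq_zero_add' ENNReal.summable, ← tsum_pnat_eq_tsum_succ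
      (f := fun m : ℕ => ENNReal.ofReal (1 / (m : ℝ) ^ (2 * k)))]
  simp [invPow, zero_pow (show 2 * k ≠ 0 by omega)]

lemma injSum_even {n : ℕ} (a : Fin n → ℕ) (hpos : ∀ i, 0 < a i) (heven : ∀ i, Even (a i)) :
    injSum a ≠ ∞ ∧ ∃ q : ℚ, (injSum a).toReal = q * Real.pi ^ (∑ i, a i) := by
  induction n with
  | zero => exact ⟨by simp [injSum], 1, by simp [injSum]⟩
  | succ n ih =>
    obtain ⟨b, a, rfl⟩ : ∃ b c, a = Fin.cons b c := ⟨_, _, (Fin.cons_self_tail a).symm⟩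
    have hb : 0 < b := by simpa using hpos 0
    have hbe : Even b := by simpa using heven 0
    have ha : ∀ i, 0 < a i := fun i => by simpa using hpos i.succ
    have hae : ∀ i, Even (a i) := fun i => by simpa using heven i.succ
    obtain ⟨hfin, q, hq⟩ := ih a ha hae
    have hj (j : Fin n) := ih (a + Pi.single j b)
      (fun i => Nat.add_pos_left (ha i) _)
      (fun i => (hae i).add (by by_cases h : i = j <;> simp [h, hbe]))
    choose hjfin r hr using hj
    obtain ⟨s, hs0, hs⟩ := tsum_invPow_even hb hbe
    have hrec := tsum_invPow_mul_injSum b a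
    have htop : injSum (Fin.cons b a : Fin (n + 1) → ℕ) ≠ ∞ := by
      refine ne_top_of_le_ne_top ?_ (hrec ▸ le_self_add)
      rw [hs]
      exact ENNReal.mul_ne_top ENNReal.ofReal_ne_top hfin
    refine ⟨htop, s * q - ∑ j, r j, ?_⟩
    have hreal := congrArg ENNReal.toReal hrec
    rw [ENNReal.toReal_mul, ENNReal.toReal_add htop (ENNReal.sum_ne_top.2 fun j _ => hjfin j),
      ENNReal.toReal_sum fun j _ => hjfin j, hs, ENNReal.toReal_ofReal hs0, hq] at hreal
    simp only [hr, Pi.add_apply, Finset.sum_add_distrib, Finset.sum_pi_single', Finset.mem_univ,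
      if_true, ← Finset.sum_mul] at hreal
    rw [Fin.sum_univ_succ]
    simp only [Fin.cons_zero, Fin.cons_succ]
    push_cast
    rw [eq_sub_of_add_eq hreal.symm]
    ring

/-- The sum defining `mz`, as an extended nonnegative real. -/
def decrSum {n : ℕ} (a : Fin n → ℕ) : ℝ≥0∞ :=
  ∑' f : {f : Fin n → ℕ+ // StrictAnti f}, ∏ i, invPow (f.1 i) (a i)

/-- Strictly decreasing tuples of positive integers, as tuples of natural numbers. -/
def strictAntiPNatEquiv (n : ℕ) : {f : Fin n → ℕ+ // StrictAnti f} ≃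
    {f : Fin n → ℕ // (∀ i, 0 < f i) ∧ ∀ i j : Fin n, i < j → f j < f i} where
  toFun f := ⟨fun i => f.1 i, fun i => (f.1 i).pos, fun _ _ h => f.2 h⟩
  invFun f := ⟨fun i => ⟨f.1 i, f.2.1 i⟩, fun i j h => f.2.2 i j h⟩
  left_inv _ := rfl
  right_inv _ := rfl

lemma mz_eq_toReal_decrSum {n : ℕ} (a : Fin n → ℕ) : mz a = (decrSum a).toReal := by
  have htop (f : {f : Fin n → ℕ+ // StrictAnti f}) : ∏ i, invPow (f.1 i) (a i) ≠ ∞ :=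
    ENNReal.prod_ne_top fun i _ => ENNReal.ofReal_ne_top
  rw [mz, decrSum, ENNReal.tsum_toReal_eq htop, ← (strictAntiPNatEquiv n).tsum_eq]
  refine tsum_congr fun f => ?_
  rw [ENNReal.toReal_prod]
  refine Finset.prod_congr rfl fun i _ => ?_
  rw [invPow, ENNReal.toReal_ofReal (by positivity)]
  rfl

lemma sum_decrSum_comp_perm {n : ℕ} (a : Fin n → ℕ) :
    ∑ σ : Equiv.Perm (Fin n), decrSum (a ∘ σ) = injSum a := by
  let F : Equiv.Perm (Fin n) × {f : Fin n → ℕ+ // StrictAnti f} → (Fin n ↪ ℕ+) :=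
    fun p => p.1.symm.toEmbedding.trans ⟨p.2.1, p.2.2.injective⟩
  have hF : Function.Bijective F := by
    constructor
    · rintro ⟨σ, f⟩ ⟨τ, g⟩ h
      have hfg (i : Fin n) : f.1 (σ.symm i) = g.1 (τ.symm i) := DFunLike.congr_fun h i
      have hval : f.1 = g.1 := by
        have := Tuple.unique_monotone (f := OrderDual.toDual ∘ f.1) (σ := 1) (τ := σ.symm * τ)
          (fun i j hij => f.2.antitone hij)
          (fun i j hij => by
            have := g.2.antitone hij
            simpa [hfg] using this)
        funext i
        have h1 := congrFun this i
        simpa [hfg] using h1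
      obtain rfl : f = g := Subtype.ext hval
      have hστ : σ.symm = τ.symm := Equiv.ext fun i => f.2.injective (hfg i)
      rw [Equiv.symm_bijective.injective hστ]
    · intro f
      let σ := Tuple.sort (OrderDual.toDual ∘ f)
      have hσ : Antitone (f ∘ σ) := fun i j hij => Tuple.monotone_sort (OrderDual.toDual ∘ f) hij
      refine ⟨⟨σ, f ∘ σ, hσ.strictAnti_of_injective (f.injective.comp σ.injective)⟩, ?_⟩
      ext i
      simp [F]
  rw [injSum, ← (Equiv.ofBijective F hF).tsum_eq, ENNReal.tsum_prod', tsum_fintype]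
  refine Finset.sum_congr rfl fun σ _ => tsum_congr fun f => ?_
  rw [← Equiv.prod_comp σ (fun i => invPow _ (a i))]
  simp [F]

end Series

theorem Z_of_sha_of_evens (sh : H →ₗ[ℚ] H →ₗ[ℚ] H)
    (hshL : ∀ w : H, H1mem w → sh 1 w = w)
    (hshR : ∀ w : H, H1mem w → sh w 1 = w)
    (hshrec : ∀ (a b : ℕ), 1 ≤ a → 1 ≤ b → ∀ w w' : H, H1mem w → H1mem w' →
      sh (z a * w) (z b * w') = z a * sh w (z b * w') + z b * sh (z a * w) w')
    (Z : H →ₗ[ℚ] ℝ)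
    (hZ : ∀ (m : ℕ) (k : Fin m → ℕ), (∀ i, 1 ≤ k i) → (∀ h : 0 < m, 2 ≤ k ⟨0, h⟩) →
      Z ((List.ofFn fun i => z (k i)).prod) = mz k)
    (n : ℕ) (a : Fin n → ℕ) (hpos : ∀ i, 0 < a i) (heven : ∀ i, Even (a i)) :
    ∃ q : ℚ, Z ((List.ofFn fun i => z (a i)).foldr (fun u v => sh u v) 1) =
      q * Real.pi ^ (∑ i, a i) := by
  obtain ⟨hfin, q, hq⟩ := injSum_even a hpos heven
  refine ⟨q, ?_⟩
  have hmap : (List.ofFn fun i => z (a i)) = (List.ofFn a).map z := by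
    rw [List.map_ofFn]
    rfl
  have hperm (σ : Equiv.Perm (Fin n)) :
      Z (((List.ofFn (a ∘ σ)).map z).prod) = (decrSum (a ∘ σ)).toReal := by
    rw [List.map_ofFn, ← mz_eq_toReal_decrSum]
    refine hZ n (a ∘ σ) (fun i => hpos _) fun h => ?_
    have h1 := hpos (σ ⟨0, h⟩)
    obtain ⟨c, hc⟩ := heven (σ ⟨0, h⟩)
    simp only [Function.comp_apply]
    omega
  rw [hmap, foldr_sh_eq_sum_permutations' sh hshL hshR hshrec _
      (by simpa [List.mem_ofFn, Nat.one_le_iff_ne_zero, Nat.pos_iff_ne_zero] using hpos),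
    sum_permutations'_ofFn, map_sum, Finset.sum_congr rfl fun σ _ => hperm σ, ← hq,
    ← sum_decrSum_comp_perm, ENNReal.toReal_sum]
  intro σ hσ
  rw [← sum_decrSum_comp_perm] at hfin
  exact ENNReal.sum_ne_top.1 hfin σ hσ

end
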